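/- G-formula identification for two time points under sequential ignorability: let X be a baseline covariate, A_1, A_2 ∈ {0,1} treatments, {M^{(a_1)}} and {Y^{(a_1,a_2)}} families of counterfactual variables, and let M := M^{(A_1)} and Y := Y^{(A_1,A_2)} (consistency). Fix (a_1, a_2) ∈ {0,1}² and assume the joint law of (X, A_1, M, A_2, Y) is strictly positive on its finite state space. Assume (SI1) P(A_1 = a_1 | X = x, M^{(a_1)} = m, Y^{(a_1,a_2)} = y) = P(A_1 = a_1 | X = x) for all x, m, y, and (SI2) P(A_2 = a_2 | X = x, A_1 = a_1, M = m, Y^{(a_1,a_2)} = y) = P(A_2 = a_2 | X = x, A_1 = a_1, M = m) for all x, m, y. Then for all x, m, y: P(X = x, M^{(a_1)} = m, Y^{(a_1,a_2)} = y) = P(X = x) · P(M = m | X = x, A_1 = a_1) · P(Y = y | X = x, A_1 = a_1, M = m, A_2 = a_2); consequently P(Y^{(a_1,a_2)} = y) = Σ_{x,m} P(X = x) · P(M = m | X = x, A_1 = a_1) · P(Y = y | X = x, A_1 = a_1, M = m, A_2 = a_2). -/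

import Mathlib

open MeasureTheory

/-- `Pr P A` is the probability of the event `A` under the probability measure `P`. -/
noncomputable def Pr {Ω : Type*} [MeasurableSpace Ω] (P : Measure Ω) (A : Set Ω) : ℝ :=
  (P A).toReal

/-- `cPr P A B` is the conditional probability `P(A | B) = P(A ∩ B) / P(B)`. -/
noncomputable def cPr {Ω : Type*} [MeasurableSpace Ω] (P : Measure Ω) (A B : Set Ω) : ℝ :=
  Pr P (A ∩ B) / Pr P B

/-- Law of total probability for a finitely valued random variable. -/
theorem Pr_eq_sum_fiber {Ω ι : Type*} [MeasurableSpace Ω] (P : Measure Ω) [IsFiniteMeasure P]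
    [Fintype ι] (Z : Ω → ι) (hZ : ∀ i, MeasurableSet {ω | Z ω = i})
    {B : Set Ω} (hB : MeasurableSet B) :
    Pr P B = ∑ i, Pr P ({ω | Z ω = i} ∩ B) := by
  have hU : B = ⋃ i ∈ (Finset.univ : Finset ι), ({ω | Z ω = i} ∩ B) := by
    ext ω
    simp
  have hd : Set.PairwiseDisjoint (↑(Finset.univ : Finset ι)) fun i => {ω | Z ω = i} ∩ B := by
    intro i _ j _ hij
    refine Set.disjoint_left.2 ?_
    rintro ω ⟨hi, _⟩ ⟨hj, _⟩
    exact hij (hi.symm.trans hj)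
  conv_lhs => rw [hU]
  exact measureReal_biUnion_finset hd fun i _ => (hZ i).inter hB

theorem Pr_mono {Ω : Type*} [MeasurableSpace Ω] (P : Measure Ω) [IsFiniteMeasure P]
    {A B : Set Ω} (h : A ⊆ B) : Pr P A ≤ Pr P B :=
  measureReal_mono h

/-- g-formula identification for two time points under sequential
ignorability. -/
theorem g_formula_two_timepoints
    {Ω : Type*} [MeasurableSpace Ω] (P : Measure Ω) [IsProbabilityMeasure P]
    {χ μ γ : Type*} [Fintype χ] [Nonempty χ] [Fintype μ] [Nonempty μ]
    [Fintype γ] [Nonempty γ]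
    (X : Ω → χ) (A₁ A₂ : Ω → Bool)
    (Mc : Bool → Ω → μ) (Yc : Bool → Bool → Ω → γ)
    (M : Ω → μ) (Y : Ω → γ)
    -- consistency
    (hM : ∀ ω, M ω = Mc (A₁ ω) ω) (hY : ∀ ω, Y ω = Yc (A₁ ω) (A₂ ω) ω)
    -- measurability of the random variables
    (hmX : ∀ x, MeasurableSet {ω | X ω = x})
    (hmA₁ : ∀ b, MeasurableSet {ω | A₁ ω = b})
    (hmA₂ : ∀ b, MeasurableSet {ω | A₂ ω = b})
    (hmMc : ∀ b m, MeasurableSet {ω | Mc b ω = m})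
    (hmYc : ∀ b₁ b₂ y, MeasurableSet {ω | Yc b₁ b₂ ω = y})
    (a₁ a₂ : Bool)
    -- strict positivity of the joint law of (X, A₁, M, A₂, Y)
    (hpos : ∀ (x : χ) (b₁ : Bool) (m : μ) (b₂ : Bool) (y : γ),
      0 < Pr P {ω | X ω = x ∧ A₁ ω = b₁ ∧ M ω = m ∧ A₂ ω = b₂ ∧ Y ω = y})
    -- (SI1)
    (hSI1 : ∀ (x : χ) (m : μ) (y : γ),
      0 < Pr P {ω | X ω = x ∧ Mc a₁ ω = m ∧ Yc a₁ a₂ ω = y} →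
      cPr P {ω | A₁ ω = a₁} {ω | X ω = x ∧ Mc a₁ ω = m ∧ Yc a₁ a₂ ω = y}
        = cPr P {ω | A₁ ω = a₁} {ω | X ω = x})
    -- (SI2)
    (hSI2 : ∀ (x : χ) (m : μ) (y : γ),
      0 < Pr P {ω | X ω = x ∧ A₁ ω = a₁ ∧ M ω = m ∧ Yc a₁ a₂ ω = y} →
      cPr P {ω | A₂ ω = a₂} {ω | X ω = x ∧ A₁ ω = a₁ ∧ M ω = m ∧ Yc a₁ a₂ ω = y}
        = cPr P {ω | A₂ ω = a₂} {ω | X ω = x ∧ A₁ ω = a₁ ∧ M ω = m}) :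
    ∀ (x : χ) (m : μ) (y : γ),
      (Pr P {ω | X ω = x ∧ Mc a₁ ω = m ∧ Yc a₁ a₂ ω = y}
        = Pr P {ω | X ω = x}
          * cPr P {ω | M ω = m} {ω | X ω = x ∧ A₁ ω = a₁}
          * cPr P {ω | Y ω = y} {ω | X ω = x ∧ A₁ ω = a₁ ∧ M ω = m ∧ A₂ ω = a₂})
      ∧ Pr P {ω | Yc a₁ a₂ ω = y}
          = ∑ x' : χ, ∑ m' : μ,
              Pr P {ω | X ω = x'}
                * cPr P {ω | M ω = m'} {ω | X ω = x' ∧ A₁ ω = a₁}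
                * cPr P {ω | Y ω = y} {ω | X ω = x' ∧ A₁ ω = a₁ ∧ M ω = m' ∧ A₂ ω = a₂} := by
  have key : ∀ (x : χ) (m : μ) (y : γ),
      Pr P {ω | X ω = x ∧ Mc a₁ ω = m ∧ Yc a₁ a₂ ω = y}
        = Pr P {ω | X ω = x}
          * cPr P {ω | M ω = m} {ω | X ω = x ∧ A₁ ω = a₁}
          * cPr P {ω | Y ω = y} {ω | X ω = x ∧ A₁ ω = a₁ ∧ M ω = m ∧ A₂ ω = a₂} := by
    intro x m y
    have hF := hpos x a₁ m a₂ y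
    have hJ : 0 < Pr P {ω | X ω = x ∧ A₁ ω = a₁ ∧ M ω = m ∧ Yc a₁ a₂ ω = y} := by
      refine hF.trans_le (Pr_mono P ?_)
      rintro ω ⟨h1, h2, h3, h4, h5⟩
      refine ⟨h1, h2, h3, ?_⟩
      rw [← h5, hY, h2, h4]
    have hE : 0 < Pr P {ω | X ω = x ∧ Mc a₁ ω = m ∧ Yc a₁ a₂ ω = y} := by
      refine hJ.trans_le (Pr_mono P ?_)
      rintro ω ⟨h1, h2, h3, h4⟩
      refine ⟨h1, ?_, h4⟩
      rw [← h3, hM, h2]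
    have hX : 0 < Pr P {ω | X ω = x} :=
      hF.trans_le (Pr_mono P fun ω h => h.1)
    have hXA : 0 < Pr P {ω | X ω = x ∧ A₁ ω = a₁} :=
      hF.trans_le (Pr_mono P fun ω h => ⟨h.1, h.2.1⟩)
    have hXAM : 0 < Pr P {ω | X ω = x ∧ A₁ ω = a₁ ∧ M ω = m} :=
      hF.trans_le (Pr_mono P fun ω h => ⟨h.1, h.2.1, h.2.2.1⟩)
    have hXAMA : 0 < Pr P {ω | X ω = x ∧ A₁ ω = a₁ ∧ M ω = m ∧ A₂ ω = a₂} :=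
      hF.trans_le (Pr_mono P fun ω h => ⟨h.1, h.2.1, h.2.2.1, h.2.2.2.1⟩)
    have e1 : {ω | A₁ ω = a₁} ∩ {ω | X ω = x ∧ Mc a₁ ω = m ∧ Yc a₁ a₂ ω = y}
        = {ω | X ω = x ∧ A₁ ω = a₁ ∧ M ω = m ∧ Yc a₁ a₂ ω = y} := by
      ext ω
      simp only [Set.mem_inter_iff, Set.mem_ofPred_eq, hM]
      grind
    have e2 : {ω | A₁ ω = a₁} ∩ {ω | X ω = x} = {ω | X ω = x ∧ A₁ ω = a₁} :=
      Set.inter_comm _ _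
    have e3 : {ω | A₂ ω = a₂} ∩ {ω | X ω = x ∧ A₁ ω = a₁ ∧ M ω = m ∧ Yc a₁ a₂ ω = y}
        = {ω | X ω = x ∧ A₁ ω = a₁ ∧ M ω = m ∧ A₂ ω = a₂ ∧ Y ω = y} := by
      ext ω
      simp only [Set.mem_inter_iff, Set.mem_ofPred_eq, hY]
      grind
    have e4 : {ω | A₂ ω = a₂} ∩ {ω | X ω = x ∧ A₁ ω = a₁ ∧ M ω = m}
        = {ω | X ω = x ∧ A₁ ω = a₁ ∧ M ω = m ∧ A₂ ω = a₂} := by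
      ext ω
      simp only [Set.mem_inter_iff, Set.mem_ofPred_eq]
      tauto
    have e5 : {ω | M ω = m} ∩ {ω | X ω = x ∧ A₁ ω = a₁}
        = {ω | X ω = x ∧ A₁ ω = a₁ ∧ M ω = m} := by
      ext ω
      simp only [Set.mem_inter_iff, Set.mem_ofPred_eq]
      tauto
    have e6 : {ω | Y ω = y} ∩ {ω | X ω = x ∧ A₁ ω = a₁ ∧ M ω = m ∧ A₂ ω = a₂}
        = {ω | X ω = x ∧ A₁ ω = a₁ ∧ M ω = m ∧ A₂ ω = a₂ ∧ Y ω = y} := by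
      ext ω
      simp only [Set.mem_inter_iff, Set.mem_ofPred_eq]
      tauto
    have s1 := hSI1 x m y hE
    have s2 := hSI2 x m y hJ
    unfold cPr at s1 s2 ⊢
    rw [e1, e2, div_eq_div_iff hE.ne' hX.ne'] at s1
    rw [e3, e4, div_eq_div_iff hJ.ne' hXAM.ne'] at s2
    rw [e5, e6, mul_assoc, div_mul_div_comm, mul_div_assoc', eq_div_iff (mul_pos hXA hXAMA).ne']
    linear_combination (-Pr P {ω | X ω = x ∧ A₁ ω = a₁ ∧ M ω = m ∧ A₂ ω = a₂}) * s1
      - Pr P {ω | X ω = x} * s2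
  refine fun x m y => ⟨key x m y, ?_⟩
  rw [Pr_eq_sum_fiber P X hmX (hmYc a₁ a₂ y)]
  refine Finset.sum_congr rfl fun x' _ => ?_
  rw [Pr_eq_sum_fiber P (Mc a₁) (hmMc a₁) ((hmX x').inter (hmYc a₁ a₂ y))]
  refine Finset.sum_congr rfl fun m' _ => ?_
  rw [← key x' m' y, Set.inter_left_comm]
  rfl
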